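/- arXiv:2403.14261 — 4 statements merged into one kernel-verified Lean document; each statement's English description precedes it below -/
import Mathlib

section
/- If α₁, α₂, β₁, β₂ are partitions with |α₁| = |β₁|, |α₂| = |β₂|, α₁ ≤ β₁ and α₂ ≤ β₂ in the dominance order, then α₁ ⊔ α₂ ≤ β₁ ⊔ β₂ in the dominance order. -/
/-- A partition: a finite multiset of positive integers. -/
def IsPartition (p : Multiset ℕ) : Prop := ∀ x ∈ p, 0 < x

/-- The parts of `p` in weakly decreasing order. -/
def descList (p : Multiset ℕ) : List ℕ := (p.sort (· ≤ ·)).reverse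

/-- The sum of the `j` largest parts of `p` (padding with trailing zeros). -/
def topSum (p : Multiset ℕ) (j : ℕ) : ℕ := ((descList p).take j).sum

/-- Dominance order: `DomLE α β` means `α ≤ β`, i.e. each partial sum of the
largest parts of `α` is at most the corresponding partial sum for `β`. -/
def DomLE (α β : Multiset ℕ) : Prop := ∀ j : ℕ, topSum α j ≤ topSum β j

/-- Transpose of a partition: the `j`-th part is the number of parts `≥ j`. -/
def transposeP (p : Multiset ℕ) : Multiset ℕ :=
  ((Multiset.range p.sum).map fun j => (p.filter fun x => j + 1 ≤ x).card).filter
    fun c => c ≠ 0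

/-- The weakly decreasing list of parts padded with zeros to length `n`. -/
def padDesc (p : Multiset ℕ) (n : ℕ) : List ℕ :=
  descList p ++ List.replicate (n - Multiset.card p) 0

/-- The sum of two partitions: add the parts pointwise after sorting in
weakly decreasing order and padding with trailing zeros. -/
def sumParts (p q : Multiset ℕ) : Multiset ℕ :=
  (↑(List.zipWith (· + ·)
      (padDesc p (max (Multiset.card p) (Multiset.card q)))
      (padDesc q (max (Multiset.card p) (Multiset.card q)))) : Multiset ℕ).filter
    fun x => x ≠ 0

/-- The string `[a] = (a, a-2, a-4, …, 2 or 1)`, empty for `a = 0`. -/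
def strP (a : ℕ) : Multiset ℕ := (Multiset.range ((a + 1) / 2)).map fun k => a - 2 * k

/-- The partition `(a, a-1, …, 2, 1)`. -/
def downP (a : ℕ) : Multiset ℕ := (Multiset.range a).map fun k => a - k

/-- The partition `(2a-1, 2a-3, …, 3, 1)`. -/
def oddsDown (a : ℕ) : Multiset ℕ := (Multiset.range a).map fun k => 2 * (a - k) - 1

/-- The partition `(2a, 2a-2, …, 4, 2)`. -/
def evensDown (a : ℕ) : Multiset ℕ := (Multiset.range a).map fun k => 2 * (a - k)

/-- `p⁻`: decrease the smallest part of `p` by 1 (deleting it if it was 1). -/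
def pMinus (p : Multiset ℕ) : Multiset ℕ :=
  match p.sort (· ≤ ·) with
  | [] => 0
  | a :: rest => (↑rest : Multiset ℕ) + (if a ≤ 1 then 0 else {a - 1})

/-- A partition is symplectic if every odd part occurs with even multiplicity. -/
def IsSymplectic (p : Multiset ℕ) : Prop := ∀ x : ℕ, Odd x → Even (p.count x)

/-- A partition is orthogonal if every even part occurs with even multiplicity. -/
def IsOrthogonal (p : Multiset ℕ) : Prop := ∀ x : ℕ, Even x → Even (p.count x)

/-- `IsCCollapse p q`: `q` is the C-collapse `p_C` of `p`, i.e. the unique maximal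
symplectic partition of the same total that is `≤ p` in the dominance order. -/
def IsCCollapse (p q : Multiset ℕ) : Prop :=
  IsPartition q ∧ IsSymplectic q ∧ q.sum = p.sum ∧ DomLE q p ∧
    ∀ r : Multiset ℕ, IsPartition r → IsSymplectic r → r.sum = p.sum → DomLE r p → DomLE r q

/-- The first `k` entries of a weakly decreasing list have the largest sum among
the sub-multisets with at most `k` elements. -/
theorem sum_le_sum_take_of_sortedGE (l : List ℕ) (hl : l.Pairwise (· ≥ ·)) (m : Multiset ℕ)
    (hm : m ≤ (l : Multiset ℕ)) (k : ℕ) (hk : Multiset.card m ≤ k) :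
    m.sum ≤ (l.take k).sum := by
  induction l generalizing m k with
  | nil =>
    have h0 : m = 0 := by simpa using hm
    simp [h0]
  | cons a l ih =>
    rw [List.pairwise_cons] at hl
    rw [← Multiset.cons_coe] at hm
    obtain rfl | ⟨x, hx⟩ := m.empty_or_exists_mem
    · simp
    obtain ⟨y, hy, hya, hle⟩ : ∃ y ∈ m, y ≤ a ∧ m.erase y ≤ (l : Multiset ℕ) := by
      by_cases ha : a ∈ m
      · exact ⟨a, ha, le_rfl, Multiset.erase_le_iff_le_cons.2 hm⟩
      · have hml := (Multiset.le_cons_of_notMem ha).1 hm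
        exact ⟨x, hx, hl.1 x (by simpa using Multiset.mem_of_le hml hx),
          (Multiset.erase_le x m).trans hml⟩
    have hcard := Multiset.card_erase_add_one hy
    obtain ⟨k, rfl⟩ : ∃ j, k = j + 1 := ⟨k - 1, by omega⟩
    have hrec := ih hl.2 _ hle k (by omega)
    have hsum := Multiset.sum_erase hy
    simp only [List.take_succ_cons, List.sum_cons]
    omega

theorem coe_descList (p : Multiset ℕ) : (descList p : Multiset ℕ) = p := by
  simp [descList]

theorem descList_pairwise (p : Multiset ℕ) : (descList p).Pairwise (· ≥ ·) := by
  rw [descList, List.pairwise_reverse]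
  exact Multiset.pairwise_sort p (· ≤ ·)

theorem sum_le_topSum {p s : Multiset ℕ} (hs : s ≤ p) {k : ℕ} (hk : Multiset.card s ≤ k) :
    s.sum ≤ topSum p k :=
  sum_le_sum_take_of_sortedGE _ (descList_pairwise p) s (by rwa [coe_descList]) k hk

theorem exists_le_sum_eq_topSum (p : Multiset ℕ) (k : ℕ) :
    ∃ s ≤ p, Multiset.card s ≤ k ∧ s.sum = topSum p k := by
  refine ⟨((descList p).take k : List ℕ), ?_, ?_, ?_⟩
  · conv_rhs => rw [← coe_descList p]
    exact (List.take_sublist k _).subperm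
  · simp
  · simp [topSum]

/-- dominance order is compatible with concatenation of partitions. -/
theorem dominance_concat_mono (α₁ α₂ β₁ β₂ : Multiset ℕ)
    (hα₁ : IsPartition α₁) (hα₂ : IsPartition α₂)
    (hβ₁ : IsPartition β₁) (hβ₂ : IsPartition β₂)
    (hsum₁ : α₁.sum = β₁.sum) (hsum₂ : α₂.sum = β₂.sum)
    (h₁ : DomLE α₁ β₁) (h₂ : DomLE α₂ β₂) :
    DomLE (α₁ + α₂) (β₁ + β₂) := by
  intro k
  obtain ⟨s, hs, hsk, hsum⟩ := exists_le_sum_eq_topSum (α₁ + α₂) k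
  have hsplit : s - α₁ + s ∩ α₁ = s := Multiset.sub_add_inter s α₁
  obtain ⟨t₁, ht₁, hc₁, hs₁⟩ := exists_le_sum_eq_topSum β₁ (Multiset.card (s ∩ α₁))
  obtain ⟨t₂, ht₂, hc₂, hs₂⟩ := exists_le_sum_eq_topSum β₂ (Multiset.card (s - α₁))
  have hcard := congrArg Multiset.card hsplit
  rw [Multiset.card_add] at hcard
  calc topSum (α₁ + α₂) k = (s - α₁).sum + (s ∩ α₁).sum := by
        rw [← hsum, ← Multiset.sum_add, hsplit]
    _ ≤ t₂.sum + t₁.sum := by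
        rw [hs₁, hs₂]
        exact add_le_add
          ((sum_le_topSum (Multiset.sub_le_iff_le_add'.2 hs) le_rfl).trans (h₂ _))
          ((sum_le_topSum Multiset.inter_le_right le_rfl).trans (h₁ _))
    _ = (t₁ + t₂).sum := by rw [Multiset.sum_add, add_comm]
    _ ≤ topSum (β₁ + β₂) k :=
        sum_le_topSum (add_le_add ht₁ ht₂) (by rw [Multiset.card_add]; omega)
end

section
/- For integers m₁ ≥ m₂ ≥ 0 with m₁ ≥ 1 and k ≥ 1, the transpose of the partition consisting of exactly 2k parts equal to each element of the multiset [m₁+m₂] ⊔ [m₁−m₂−1] equals the concatenation (2m₁k, 2(m₁−1)k, …, 4k, 2k) ⊔ (2m₂k, 2(m₂−1)k, …, 4k, 2k) (the second factor being empty if m₂ = 0). -/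
theorem strP_add_two (a : ℕ) : strP (a + 2) = (a + 2) ::ₘ strP a := by
  have hr : (a + 2 + 1) / 2 = 1 + (a + 1) / 2 := by omega
  unfold strP
  rw [hr, Multiset.range_add, Multiset.map_add, Multiset.map_map]
  have hone : Multiset.range 1 = {0} := rfl
  rw [hone, Multiset.map_singleton, Multiset.singleton_add]
  congr 1
  refine Multiset.map_congr rfl fun x _ => ?_
  simp only [Function.comp_apply]
  omega

/-- The number of parts of the string `[a]` that exceed `j`. -/
theorem card_filter_le_strP (a j : ℕ) :
    ((strP a).filter fun x => j + 1 ≤ x).card = (a + 1 - j) / 2 := by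
  induction a using Nat.twoStepInduction with
  | zero => simp [strP]; omega
  | one =>
    have hone : strP 1 = {1} := rfl
    rw [hone, Multiset.filter_singleton]
    split_ifs <;> simp <;> omega
  | more a ih _ =>
    rw [strP_add_two, Multiset.filter_cons, Multiset.card_add, ih]
    split_ifs <;> simp <;> omega

theorem downP_add (a b : ℕ) :
    downP (a + b) = (Multiset.range a).map (fun j => a + b - j) + downP b := by
  unfold downP
  rw [Multiset.range_add, Multiset.map_add, Multiset.map_map]
  congr 1
  refine Multiset.map_congr rfl fun x _ => ?_
  simp only [Function.comp_apply]
  omega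

theorem map_range_two_mul_half (b : ℕ) :
    (Multiset.range (2 * b)).map (fun t => (2 * b + 1 - t) / 2) = downP b + downP b := by
  induction b with
  | zero => rfl
  | succ b ih =>
    have hdown : downP (b + 1) = (b + 1) ::ₘ downP b := by
      rw [add_comm b 1, downP_add]
      rfl
    have htwo : Multiset.range 2 = 0 ::ₘ {1} := rfl
    rw [hdown, show 2 * (b + 1) = 2 + 2 * b by ring, Multiset.range_add, Multiset.map_add,
      Multiset.map_map, htwo, Multiset.map_cons, Multiset.map_singleton, Multiset.cons_add,
      Multiset.cons_add, Multiset.add_cons, ← ih, Multiset.singleton_add]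
    congr 1
    · omega
    congr 1
    · omega
    refine Multiset.map_congr rfl fun x _ => ?_
    simp only [Function.comp_apply]
    omega

/-- The transpose may be computed from any `n` that separates the nonzero column lengths from
the zero ones. -/
theorem transposeP_eq_map_range {p : Multiset ℕ} {f : ℕ → ℕ} {n : ℕ} (hn : n ≤ p.sum)
    (hf : ∀ j, (p.filter fun x => j + 1 ≤ x).card = f j)
    (hpos : ∀ j < n, f j ≠ 0) (hzero : ∀ j, n ≤ j → f j = 0) :
    transposeP p = (Multiset.range n).map f := by
  obtain ⟨d, hd⟩ := Nat.exists_eq_add_of_le hn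
  unfold transposeP
  simp only [hf]
  rw [hd, Multiset.range_add, Multiset.map_add, Multiset.filter_add, Multiset.map_map,
    Multiset.filter_eq_self.2, Multiset.filter_eq_nil.2, add_zero]
  · simp only [Multiset.mem_map, Function.comp_apply]
    rintro _ ⟨x, _, rfl⟩
    simpa using hzero (n + x) (Nat.le_add_right n x)
  · simp only [Multiset.mem_map, Multiset.mem_range]
    rintro _ ⟨x, hx, rfl⟩
    exact hpos x hx

theorem le_sum_strP (a : ℕ) : a ≤ (strP a).sum := by
  rcases Nat.eq_zero_or_pos a with rfl | ha
  · exact Nat.zero_le _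
  · refine Multiset.le_sum_of_mem (Multiset.mem_map.2 ⟨0, ?_, by simp⟩)
    rw [Multiset.mem_range]
    omega

/-- for `m₁ ≥ m₂ ≥ 0`, `m₁ ≥ 1`, `k ≥ 1`, the transpose of the partition
with exactly `2k` parts equal to each element of `[m₁+m₂] ⊔ [m₁-m₂-1]` is
`(2m₁k, …, 4k, 2k) ⊔ (2m₂k, …, 4k, 2k)`. -/
theorem transpose_smul_strings (m₁ m₂ k : ℕ) (h : m₂ ≤ m₁) (hm : 1 ≤ m₁) (hk : 1 ≤ k) :
    transposeP ((2 * k) • (strP (m₁ + m₂) + strP (m₁ - m₂ - 1))) =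
      (downP m₁).map (fun x => 2 * k * x) + (downP m₂).map (fun x => 2 * k * x) := by
  obtain ⟨a, rfl⟩ := Nat.exists_eq_add_of_le' h
  rw [transposeP_eq_map_range (n := a + m₂ + m₂)
    (f := fun j => 2 * k * ((a + m₂ + m₂ + 1 - j) / 2 + (a + m₂ - m₂ - 1 + 1 - j) / 2))]
  · rw [← Multiset.map_add, downP_add, add_assoc (Multiset.map _ _), ← map_range_two_mul_half,
      show a + m₂ + m₂ = a + 2 * m₂ by ring, Multiset.range_add, Multiset.map_add,
      Multiset.map_add, Multiset.map_map, Multiset.map_map, Multiset.map_map]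
    congr 1 <;> refine Multiset.map_congr rfl fun x hx => ?_ <;>
      rw [Multiset.mem_range] at hx <;> simp only [Function.comp_apply] <;> congr 1 <;> omega
  · rw [Multiset.sum_nsmul, Multiset.sum_add, smul_eq_mul]
    exact ((le_sum_strP _).trans (Nat.le_add_right _ _)).trans
      (Nat.le_mul_of_pos_left _ (by omega))
  · intro j
    rw [Multiset.filter_nsmul, Multiset.card_nsmul, Multiset.filter_add, Multiset.card_add,
      card_filter_le_strP, card_filter_le_strP]
  · intro j hj
    exact Nat.mul_ne_zero (by omega) (by omega)
  · intro j hj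
    exact mul_eq_zero_of_right _ (by omega)
end

section
/- For integers M ≥ m ≥ 0, one has the partition identity [2(M+m)+1]ᵗ + [2(M−m)−1]ᵗ = A ⊔ B, where A is the partition with one part 2M+1 and exactly two parts equal to each odd number 2M−1, 2M−3, …, 3, 1, and B is the partition with exactly two parts equal to each even number 2m, 2m−2, …, 4, 2 (B empty if m = 0). -/
theorem map_range_succ_front (n : ℕ) (f : ℕ → ℕ) :
    (Multiset.range (n + 1)).map f = f 0 ::ₘ (Multiset.range n).map fun k => f (k + 1) := by
  change ((List.range (n + 1) : Multiset ℕ)).map f =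
    f 0 ::ₘ ((List.range n : Multiset ℕ)).map fun k => f (k + 1)
  simp [List.range_succ_eq_map, Function.comp_def]

theorem descList_coe_of_pairwise {l : List ℕ} (hl : l.Pairwise (· ≥ ·)) :
    descList (l : Multiset ℕ) = l := by
  unfold descList
  refine List.Perm.eq_of_pairwise (le := (· ≥ ·)) (fun a b _ _ h1 h2 => le_antisymm h2 h1)
    ?_ hl ?_
  · rw [List.pairwise_reverse]
    exact Multiset.pairwise_sort _ _
  · exact (List.reverse_perm _).trans (Multiset.coe_eq_coe.1 (Multiset.sort_eq _ _))

theorem padDesc_map_range {f : ℕ → ℕ} (hf : Antitone f) {n N : ℕ} (hnN : n ≤ N)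
    (h0 : ∀ j, n ≤ j → f j = 0) :
    padDesc ((List.range n).map f : List ℕ) N = (List.range N).map f := by
  have hp : ((List.range n).map f).Pairwise (· ≥ ·) := by
    rw [List.pairwise_map]
    exact List.pairwise_lt_range.imp fun hab => hf hab.le
  rw [padDesc, descList_coe_of_pairwise hp]
  refine List.ext_getElem (by simp; omega) fun i h1 h2 => ?_
  by_cases hi : i < n
  · simp [hi]
  · simp [List.getElem_append, hi, h0 i (not_lt.1 hi)]

theorem strP_two_mul_sub_one (L : ℕ) :
    strP (2 * L - 1) = (Multiset.range L).map fun k => 2 * L - 1 - 2 * k := by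
  rw [strP, show (2 * L - 1 + 1) / 2 = L by omega]

theorem le_sum_strP_s11 (L : ℕ) : 2 * L - 1 ≤ (strP (2 * L - 1)).sum := by
  rw [strP_two_mul_sub_one]
  rcases L with _ | L
  · simp
  · rw [map_range_succ_front, Multiset.sum_cons]
    omega

theorem card_filter_strP (L j : ℕ) :
    ((strP (2 * L - 1)).filter fun x => j + 1 ≤ x).card = L - (j + 1) / 2 := by
  rw [strP_two_mul_sub_one, Multiset.filter_map, Multiset.card_map]
  have h : (Finset.range L).filter ((fun x => j + 1 ≤ x) ∘ fun k => 2 * L - 1 - 2 * k) =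
      Finset.range (L - (j + 1) / 2) := by
    ext k
    simp only [Finset.mem_filter, Finset.mem_range, Function.comp_apply]
    omega
  exact (congrArg Finset.card h).trans (Finset.card_range _)

theorem transposeP_strP (L : ℕ) :
    transposeP (strP (2 * L - 1)) =
      ((List.range (2 * L - 1)).map fun j => L - (j + 1) / 2 : List ℕ) := by
  have hS := le_sum_strP_s11 L
  simp only [transposeP, card_filter_strP]
  rw [Multiset.filter_map]
  have h : (Finset.range (strP (2 * L - 1)).sum).filter
      ((fun c => c ≠ 0) ∘ fun j => L - (j + 1) / 2) = Finset.range (2 * L - 1) := by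
    ext k
    simp only [Finset.mem_filter, Finset.mem_range, Function.comp_apply]
    omega
  exact congrArg (Multiset.map _) (congrArg Finset.val h)

theorem map_range_two_mul_add_one (g : ℕ → ℕ) (N : ℕ) :
    (Multiset.range (2 * N + 1)).map (fun j => g ((j + 1) / 2)) =
      {g 0} + 2 • (Multiset.range N).map fun i => g (i + 1) := by
  induction N with
  | zero => simp
  | succ N ih =>
    rw [show 2 * (N + 1) + 1 = 2 * N + 1 + 1 + 1 by ring, Multiset.range_succ,
      Multiset.map_cons, Multiset.range_succ, Multiset.map_cons, ih, Multiset.range_succ,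
      Multiset.map_cons, show (2 * N + 1 + 1 + 1) / 2 = N + 1 by omega,
      show (2 * N + 1 + 1) / 2 = N + 1 by omega]
    simp only [← Multiset.singleton_add]
    abel

theorem oddsDown_succ (a : ℕ) : oddsDown (a + 1) = (2 * a + 1) ::ₘ oddsDown a := by
  simp only [oddsDown, map_range_succ_front, Nat.add_sub_add_right]
  rfl

theorem evensDown_succ (a : ℕ) : evensDown (a + 1) = (2 * a + 2) ::ₘ evensDown a := by
  simp only [evensDown, map_range_succ_front, Nat.add_sub_add_right]
  rfl

theorem downP_two_mul (m : ℕ) : downP (2 * m) = oddsDown m + evensDown m := by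
  induction m with
  | zero => simp [downP, oddsDown, evensDown]
  | succ m ih =>
    rw [oddsDown_succ, evensDown_succ, Multiset.cons_add, Multiset.add_cons, ← ih,
      Multiset.cons_swap]
    simp only [downP, show 2 * (m + 1) = 2 * m + 1 + 1 by ring, map_range_succ_front,
      Nat.add_sub_add_right]
    rfl

theorem map_range_eq_oddsDown_add_evensDown (m K : ℕ) :
    (Multiset.range (K + 2 * m)).map (fun i => (K + 2 * m - i) + (K - (i + 1))) =
      oddsDown (m + K) + evensDown m := by
  induction K with
  | zero => simpa [downP] using downP_two_mul m
  | succ K ih =>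
    rw [← add_assoc, oddsDown_succ, Multiset.cons_add, ← ih,
      show K + 1 + 2 * m = K + 2 * m + 1 by ring, map_range_succ_front]
    simp only [Nat.add_sub_add_right]
    congr 1
    omega

/-- for `M ≥ m ≥ 0`,
`[2(M+m)+1]ᵗ + [2(M-m)-1]ᵗ = ((2M+1) ⊔ (2M-1,2M-1,…,1,1)) ⊔ (2m,2m,…,2,2)`. -/
theorem gamma_plus_identity (M m : ℕ) (h : m ≤ M) :
    sumParts (transposeP (strP (2 * (M + m) + 1))) (transposeP (strP (2 * (M - m) - 1))) =
      (({2 * M + 1} : Multiset ℕ) + 2 • oddsDown M) + 2 • evensDown m := by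
  obtain ⟨K, rfl⟩ := Nat.exists_eq_add_of_le h
  have anti (L : ℕ) : Antitone fun j : ℕ => L - (j + 1) / 2 := fun a b hab => by
    dsimp only
    omega
  rw [show 2 * (m + K + m) + 1 = 2 * (K + 2 * m + 1) - 1 by omega, Nat.add_sub_cancel_left,
    transposeP_strP, transposeP_strP, sumParts]
  simp only [Multiset.coe_card, List.length_map, List.length_range]
  rw [max_eq_left (by omega), padDesc_map_range (anti _) le_rfl fun j hj => by omega,
    padDesc_map_range (anti _) (by omega) fun j hj => by omega, List.zipWith_map,
    List.zipWith_self, Multiset.filter_eq_self.2, add_assoc {_}, ← nsmul_add,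
    ← map_range_eq_oddsDown_add_evensDown,
    show 2 * (K + 2 * m + 1) - 1 = 2 * (K + 2 * m) + 1 by omega]
  · refine (map_range_two_mul_add_one (fun i => (K + 2 * m + 1 - i) + (K - i)) _).trans ?_
    simp only [Nat.add_sub_add_right]
    congr 2
    omega
  · intro x hx
    simp only [Multiset.mem_coe, List.mem_map, List.mem_range] at hx
    obtain ⟨j, hj, rfl⟩ := hx
    omega
end

section
/- For integers a, b ≥ 0, let A be the partition with one part 2a+1 and exactly two parts equal to each odd number 2a−1, 2a−3, …, 3, 1, and let B be the partition with exactly two parts equal to each odd number 2b−1, 2b−3, …, 3, 1 (B empty if b = 0). Then: if a ≥ b, A + B is the partition with one part equal to each even number 2(a+b), 2(a+b)−2, …, 2(a−b)+2, one part 2(a−b)+1, and exactly two parts equal to each odd number 2(a−b)−1, 2(a−b)−3, …, 3, 1; if a < b, A + B is the partition with one part equal to each even number 2(a+b), 2(a+b)−2, …, 2(b−a), one part 2(b−a)−1, and exactly two parts equal to each odd number 2(b−a)−3, 2(b−a)−5, …, 3, 1. -/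
theorem descList_coe_of_pairwise_ge {l : List ℕ} (h : l.Pairwise (· ≥ ·)) :
    descList (l : Multiset ℕ) = l := by
  have hr : l.reverse.Pairwise (· ≤ ·) := List.pairwise_reverse.2 h
  rw [descList, ← Multiset.coe_reverse, Multiset.coe_sort,
    List.mergeSort_eq_self _ (by simpa using hr),
    List.reverse_reverse]

theorem padDesc_map_range_s14 {f : ℕ → ℕ} (hf : Antitone f) {c n : ℕ} (hc : f c = 0) (hn : c ≤ n) :
    padDesc ((Multiset.range c).map f) n = (List.range n).map f := by
  obtain ⟨k, rfl⟩ := Nat.exists_eq_add_of_le hn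
  have hsort : ((List.range c).map f).Pairwise (· ≥ ·) :=
    List.pairwise_map.2 (List.pairwise_lt_range.imp fun h => hf h.le)
  have hpad : (List.range k).map (f ∘ (c + ·)) = List.replicate k 0 := by
    rw [List.eq_replicate_iff]
    refine ⟨by simp, fun x hx => ?_⟩
    obtain ⟨i, -, rfl⟩ := List.mem_map.1 hx
    exact Nat.eq_zero_of_le_zero (hc ▸ hf (Nat.le_add_right c i))
  rw [padDesc, ← Multiset.coe_range, Multiset.map_coe, descList_coe_of_pairwise_ge hsort,
    List.range_add, List.map_append, List.map_map, hpad]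
  simp

theorem sumParts_map_range {f g : ℕ → ℕ} (hf : Antitone f) (hg : Antitone g) {c d : ℕ}
    (hc : f c = 0) (hd : g d = 0) :
    sumParts ((Multiset.range c).map f) ((Multiset.range d).map g) =
      ((Multiset.range (max c d)).map fun i => f i + g i).filter fun x => x ≠ 0 := by
  simp only [sumParts, Multiset.card_map, Multiset.card_range]
  rw [padDesc_map_range_s14 hf hc (le_max_left c d), padDesc_map_range_s14 hg hd (le_max_right c d),
    List.zipWith_map, List.zipWith_self, ← Multiset.map_coe, Multiset.coe_range]

theorem map_range_add {α : Type*} (f : ℕ → α) (m n : ℕ) :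
    (Multiset.range (m + n)).map f =
      (Multiset.range m).map f + (Multiset.range n).map fun i => f (m + i) := by
  rw [Multiset.range_add, Multiset.map_add, Multiset.map_map]
  rfl

theorem two_nsmul_oddsDown (c : ℕ) :
    2 • oddsDown c = (Multiset.range (2 * c)).map fun i => 2 * (c - i / 2) - 1 := by
  have key (h : ℕ → ℕ) (n : ℕ) :
      2 • (Multiset.range n).map h = (Multiset.range (2 * n)).map fun i => h (i / 2) := by
    induction n with
    | zero => simp
    | succ n ih =>
      rw [map_range_add h n 1, nsmul_add, ih, Nat.mul_succ, map_range_add _ (2 * n) 2]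
      congr 1
      simp [two_nsmul, Multiset.range_succ, show (2 * n + 1) / 2 = n by omega]
  exact key _ c

theorem singleton_add_two_nsmul_oddsDown (a : ℕ) :
    {2 * a + 1} + 2 • oddsDown a =
      (Multiset.range (2 * a + 1)).map fun i => 2 * (a + 1 - (i + 1) / 2) - 1 := by
  rw [two_nsmul_oddsDown, Nat.add_comm (2 * a) 1, map_range_add]
  congr 1
  · simp
    omega
  · exact Multiset.map_congr rfl fun i _ => by omega

/-- the `case-2` sum identity of Proposition 4.6:
`((2a+1) ⊔ 2·(2a-1,…,1)) + 2·(2b-1,…,1)`. -/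
theorem case_two_sum_identity (a b : ℕ) :
    sumParts (({2 * a + 1} : Multiset ℕ) + 2 • oddsDown a) (2 • oddsDown b) =
      if b ≤ a then
        ((Multiset.range (2 * b)).map fun i => 2 * (a + b) - 2 * i) +
          ({2 * (a - b) + 1} : Multiset ℕ) + 2 • oddsDown (a - b)
      else
        ((Multiset.range (2 * a + 1)).map fun i => 2 * (a + b) - 2 * i) +
          ({2 * (b - a) - 1} : Multiset ℕ) + 2 • oddsDown (b - a - 1) := by
  rw [singleton_add_two_nsmul_oddsDown, two_nsmul_oddsDown b,
    sumParts_map_range (fun i j h => by omega) (fun i j h => by omega)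
      (by omega) (by omega), Multiset.filter_eq_self.2]
  · split_ifs with h
    · rw [add_assoc, singleton_add_two_nsmul_oddsDown,
        show max (2 * a + 1) (2 * b) = 2 * b + (2 * (a - b) + 1) by omega, map_range_add]
      congr 1 <;> refine Multiset.map_congr rfl fun i hi => ?_ <;>
        rw [Multiset.mem_range] at hi <;> omega
    · have hs : 2 * (b - a) - 1 = 2 * (b - a - 1) + 1 := by omega
      rw [add_assoc, hs, singleton_add_two_nsmul_oddsDown,
        show max (2 * a + 1) (2 * b) = 2 * a + 1 + (2 * (b - a - 1) + 1) by omega, map_range_add]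
      congr 1 <;> refine Multiset.map_congr rfl fun i hi => ?_ <;>
        rw [Multiset.mem_range] at hi <;> omega
  · intro x hx
    obtain ⟨i, hi, rfl⟩ := Multiset.mem_map.1 hx
    rw [Multiset.mem_range] at hi
    omega
end
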